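/- Derivative bound for the modified auxiliary function Ẽ_0: Let W be a classical-quantum channel with finite input alphabet X whose outputs W_x are positive definite density operators on ℂ^d, let σ be a positive definite density operator on ℂ^d, and let P be a probability distribution on X. Then for every s ≥ 0 the derivative of s ↦ Ẽ_0(s,P,σ) := −log Σ_{x∈X} P(x)·Tr[W_x^{1−s} σ^s] at s exists and satisfies (d/ds)Ẽ_0(s,P,σ) ≤ Σ_{x∈X} P(x)·D(W_x‖σ). -/

import Mathlib

open scoped BigOperators ComplexOrder
open Filter

noncomputable section

namespace MDQ

/-- Functional calculus for Hermitian matrices (junk value `0` otherwise). -/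
noncomputable def matFun {d : ℕ} (f : ℝ → ℝ) (A : Matrix (Fin d) (Fin d) ℂ) :
    Matrix (Fin d) (Fin d) ℂ :=
  if hA : A.IsHermitian then hA.cfc f else 0

/-- Matrix logarithm on the support (`Real.log 0 = 0`). -/
noncomputable def mlog {d : ℕ} (A : Matrix (Fin d) (Fin d) ℂ) : Matrix (Fin d) (Fin d) ℂ :=
  matFun Real.log A

/-- Matrix real power, restricted to the support. -/
noncomputable def mpow {d : ℕ} (A : Matrix (Fin d) (Fin d) ℂ) (p : ℝ) :
    Matrix (Fin d) (Fin d) ℂ :=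
  matFun (fun t => if t = 0 then 0 else t ^ p) A

/-- Matrix exponential via functional calculus. -/
noncomputable def mexp {d : ℕ} (A : Matrix (Fin d) (Fin d) ℂ) : Matrix (Fin d) (Fin d) ℂ :=
  matFun Real.exp A

/-- Orthogonal projection onto the support of a Hermitian matrix. -/
noncomputable def suppProj {d : ℕ} (A : Matrix (Fin d) (Fin d) ℂ) : Matrix (Fin d) (Fin d) ℂ :=
  matFun (fun t => if t = 0 then 0 else 1) A

/-- `A` is a density operator. -/
def IsDensity {d : ℕ} (A : Matrix (Fin d) (Fin d) ℂ) : Prop :=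
  A.PosSemidef ∧ A.trace = 1

/-- Real part of the trace. -/
noncomputable def reTr {ι : Type} [Fintype ι] (A : Matrix ι ι ℂ) : ℝ :=
  A.trace.re

/-- supp ρ ⊆ supp σ, phrased via ranges of the associated linear maps. -/
def SuppLE {d : ℕ} (ρ σ : Matrix (Fin d) (Fin d) ℂ) : Prop :=
  LinearMap.range (Matrix.toLin' ρ) ≤ LinearMap.range (Matrix.toLin' σ)

/-- Quantum relative entropy `D(ρ‖σ)`. -/
noncomputable def qD {d : ℕ} (ρ σ : Matrix (Fin d) (Fin d) ℂ) : ℝ :=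
  reTr (ρ * (mlog ρ - mlog σ))

/-- Quantum relative entropy variance `V(ρ‖σ)`. -/
noncomputable def qV {d : ℕ} (ρ σ : Matrix (Fin d) (Fin d) ℂ) : ℝ :=
  reTr (ρ * (mlog ρ - mlog σ) ^ 2) - (qD ρ σ) ^ 2

/-- The variant relative entropy variance `Ṽ(ρ‖σ)`. -/
noncomputable def qVtilde {d : ℕ} (ρ σ : Matrix (Fin d) (Fin d) ℂ) : ℝ :=
  (∫ t in (0:ℝ)..1,
    reTr (mpow ρ (1 - t) * (mlog ρ - mlog σ) * mpow ρ t * (mlog ρ - mlog σ))) - (qD ρ σ) ^ 2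

/-- The quantum Rényi divergence of order zero, `D₀(ρ‖σ) = -log Tr[Π_ρ σ]`. -/
noncomputable def qD0 {d : ℕ} (ρ σ : Matrix (Fin d) (Fin d) ℂ) : ℝ :=
  - Real.log (reTr (suppProj ρ * σ))

/-- Tensor product of a finite family of `d × d` matrices. -/
noncomputable def tensorSeq {d n : ℕ} (A : Fin n → Matrix (Fin d) (Fin d) ℂ) :
    Matrix (Fin n → Fin d) (Fin n → Fin d) ℂ :=
  Matrix.of fun i j => ∏ k, A k (i k) (j k)

/-- `n`-fold tensor power of a matrix. -/
noncomputable def tensorPow {d : ℕ} (A : Matrix (Fin d) (Fin d) ℂ) (n : ℕ) :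
    Matrix (Fin n → Fin d) (Fin n → Fin d) ℂ :=
  tensorSeq (fun _ => A)

/-- Smallest type-I error with type-II error at most `μ`:  `α̂_μ(ρ‖σ)`. -/
noncomputable def hypoErr {ι : Type} [Fintype ι] [DecidableEq ι]
    (ρ σ : Matrix ι ι ℂ) (μ : ℝ) : ℝ :=
  sInf { a : ℝ | ∃ Q : Matrix ι ι ℂ, Q.PosSemidef ∧ (1 - Q).PosSemidef ∧
    reTr (Q * σ) ≤ μ ∧ a = reTr ((1 - Q) * ρ) }

/-- `P` is a probability distribution on a finite alphabet. -/
def IsProbDist {X : Type} [Fintype X] (P : X → ℝ) : Prop :=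
  (∀ x, 0 ≤ P x) ∧ ∑ x, P x = 1

/-- The average output state `PW`. -/
noncomputable def avgState {X : Type} [Fintype X] {d : ℕ}
    (P : X → ℝ) (W : X → Matrix (Fin d) (Fin d) ℂ) : Matrix (Fin d) (Fin d) ℂ :=
  ∑ x, (P x : ℂ) • W x

/-- Mutual information `I(P, W)`. -/
noncomputable def mutualInfo {X : Type} [Fintype X] {d : ℕ}
    (P : X → ℝ) (W : X → Matrix (Fin d) (Fin d) ℂ) : ℝ :=
  ∑ x, P x * qD (W x) (avgState P W)

/-- Capacity `C_W`. -/
noncomputable def capacity {X : Type} [Fintype X] {d : ℕ}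
    (W : X → Matrix (Fin d) (Fin d) ℂ) : ℝ :=
  sSup { c : ℝ | ∃ P : X → ℝ, IsProbDist P ∧ c = mutualInfo P W }

/-- Conditional information variance `V(P, W)`. -/
noncomputable def infoVar {X : Type} [Fintype X] {d : ℕ}
    (P : X → ℝ) (W : X → Matrix (Fin d) (Fin d) ℂ) : ℝ :=
  ∑ x, P x * qV (W x) (avgState P W)

/-- The variant conditional information variance `Ṽ(P, W)`. -/
noncomputable def infoVarTilde {X : Type} [Fintype X] {d : ℕ}
    (P : X → ℝ) (W : X → Matrix (Fin d) (Fin d) ℂ) : ℝ :=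
  ∑ x, P x * qVtilde (W x) (avgState P W)

/-- Minimal peripheral information variance `V_W`. -/
noncomputable def Vmin {X : Type} [Fintype X] {d : ℕ}
    (W : X → Matrix (Fin d) (Fin d) ℂ) : ℝ :=
  sInf { v : ℝ | ∃ P : X → ℝ, IsProbDist P ∧ mutualInfo P W = capacity W ∧ v = infoVar P W }

/-- Minimal variant peripheral information variance `Ṽ_W`. -/
noncomputable def VminTilde {X : Type} [Fintype X] {d : ℕ}
    (W : X → Matrix (Fin d) (Fin d) ℂ) : ℝ :=
  sInf { v : ℝ | ∃ P : X → ℝ, IsProbDist P ∧ mutualInfo P W = capacity W ∧ v = infoVarTilde P W }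

/-- Conditional relative entropy `D(W‖σ|P)`. -/
noncomputable def Dcond {X : Type} [Fintype X] {d : ℕ}
    (W : X → Matrix (Fin d) (Fin d) ℂ) (σ : Matrix (Fin d) (Fin d) ℂ) (P : X → ℝ) : ℝ :=
  ∑ x, P x * qD (W x) σ

/-- Conditional relative entropy variance `V(W‖σ|P)`. -/
noncomputable def Vcond {X : Type} [Fintype X] {d : ℕ}
    (W : X → Matrix (Fin d) (Fin d) ℂ) (σ : Matrix (Fin d) (Fin d) ℂ) (P : X → ℝ) : ℝ :=
  ∑ x, P x * qV (W x) σ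

/-- Conditional order-zero Rényi divergence `D₀(W‖σ|P)`. -/
noncomputable def D0cond {X : Type} [Fintype X] {d : ℕ}
    (W : X → Matrix (Fin d) (Fin d) ℂ) (σ : Matrix (Fin d) (Fin d) ℂ) (P : X → ℝ) : ℝ :=
  ∑ x, P x * qD0 (W x) σ

/-- The exponent function `E_h(s, P, σ)`. -/
noncomputable def Eh {X : Type} [Fintype X] {d : ℕ}
    (W : X → Matrix (Fin d) (Fin d) ℂ) (s : ℝ) (P : X → ℝ)
    (σ : Matrix (Fin d) (Fin d) ℂ) : ℝ :=
  -(1 + s) * ∑ x, P x * Real.log (reTr (mpow (W x) (1 / (1 + s)) * mpow σ (s / (1 + s))))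

/-- The log-Euclidean exponent function `Ẽ_h(s, P, σ)`. -/
noncomputable def EhTilde {X : Type} [Fintype X] {d : ℕ}
    (W : X → Matrix (Fin d) (Fin d) ℂ) (s : ℝ) (P : X → ℝ)
    (σ : Matrix (Fin d) (Fin d) ℂ) : ℝ :=
  -(1 + s) * ∑ x, P x *
    Real.log (reTr (mexp ((((1 + s)⁻¹ : ℝ) : ℂ) • (mlog (W x) + ((s : ℝ) : ℂ) • mlog σ))))

/-- The modified auxiliary function `Ẽ₀(s, P, σ)`. -/
noncomputable def E0Tilde {X : Type} [Fintype X] {d : ℕ}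
    (W : X → Matrix (Fin d) (Fin d) ℂ) (s : ℝ) (P : X → ℝ)
    (σ : Matrix (Fin d) (Fin d) ℂ) : ℝ :=
  - Real.log (∑ x, P x * reTr (mpow (W x) (1 - s) * mpow σ s))

/-- The sphere-packing exponent `E_sp^{(2)}(R, P, σ)`. -/
noncomputable def Esp2 {X : Type} [Fintype X] {d : ℕ}
    (W : X → Matrix (Fin d) (Fin d) ℂ) (R : ℝ) (P : X → ℝ)
    (σ : Matrix (Fin d) (Fin d) ℂ) : ℝ :=
  sSup { e : ℝ | ∃ s : ℝ, 0 ≤ s ∧ e = Eh W s P σ - s * R }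

/-- The sphere-packing exponent `Ẽ_sp(R, P, σ)`. -/
noncomputable def EspTilde {X : Type} [Fintype X] {d : ℕ}
    (W : X → Matrix (Fin d) (Fin d) ℂ) (R : ℝ) (P : X → ℝ)
    (σ : Matrix (Fin d) (Fin d) ℂ) : ℝ :=
  sSup { e : ℝ | ∃ s : ℝ, 0 ≤ s ∧ e = EhTilde W s P σ - s * R }

open Classical in
/-- Empirical distribution of a word `x^n ∈ X^n`. -/
noncomputable def empDist {X : Type} [Fintype X] {n : ℕ} (xs : Fin n → X) (x : X) : ℝ :=
  ((Finset.univ.filter fun i => xs i = x).card : ℝ) / n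

/-- Smallest average error probability `ε*(n, R)` over all `n`-blocklength codes with
`⌈exp (n R)⌉` messages. -/
noncomputable def optErr {X : Type} [Fintype X] {d : ℕ}
    (W : X → Matrix (Fin d) (Fin d) ℂ) (n : ℕ) (R : ℝ) : ℝ :=
  sInf { e : ℝ | ∃ (f : Fin ⌈Real.exp (n * R)⌉₊ → Fin n → X)
    (Pov : Fin ⌈Real.exp (n * R)⌉₊ → Matrix (Fin n → Fin d) (Fin n → Fin d) ℂ),
    (∀ m, (Pov m).PosSemidef) ∧ (∑ m, Pov m) = 1 ∧
    e = (1 / (⌈Real.exp (n * R)⌉₊ : ℝ)) *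
      ∑ m, (1 - reTr (Pov m * tensorSeq (fun k => W (f m k)))) }

/-- The binary entropy function. -/
noncomputable def binEnt (p : ℝ) : ℝ :=
  -p * Real.log p - (1 - p) * Real.log (1 - p)

section SpectralOverlap

variable {d : ℕ} {A B : Matrix (Fin d) (Fin d) ℂ}

/-- Squared moduli of the inner products between the eigenvectors of two Hermitian matrices. -/
noncomputable def spectralOverlap (hA : A.IsHermitian) (hB : B.IsHermitian) (i j : Fin d) : ℝ :=
  Complex.normSq
    ((star (hA.eigenvectorUnitary : Matrix (Fin d) (Fin d) ℂ) * hB.eigenvectorUnitary) i j)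

lemma matFun_mul_matFun (hA : A.IsHermitian) (f g : ℝ → ℝ) :
    matFun f A * matFun g A = matFun (fun t => f t * g t) A := by
  simp only [matFun, dif_pos hA, Matrix.IsHermitian.cfc]
  rw [← map_mul, Matrix.diagonal_mul_diagonal]
  congr 2
  ext i
  simp

lemma matFun_one (hA : A.IsHermitian) : matFun (fun _ => 1) A = 1 := by
  rw [matFun, dif_pos hA, ← hA.cfc_eq]
  exact cfc_const_one ℝ A hA

lemma matFun_id (hA : A.IsHermitian) : matFun (fun t => t) A = A := by
  rw [matFun, dif_pos hA, ← hA.cfc_eq]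
  exact cfc_id' ℝ A hA

lemma reTr_matFun_mul_matFun (hA : A.IsHermitian) (hB : B.IsHermitian) (f g : ℝ → ℝ) :
    reTr (matFun f A * matFun g B) = ∑ i, ∑ j,
      f (hA.eigenvalues i) * g (hB.eigenvalues j) * spectralOverlap hA hB i j := by
  simp only [matFun, dif_pos hA, dif_pos hB, Matrix.IsHermitian.cfc,
    Unitary.conjStarAlgAut_apply, reTr, spectralOverlap]
  set U := (hA.eigenvectorUnitary : Matrix (Fin d) (Fin d) ℂ)
  set V := (hB.eigenvectorUnitary : Matrix (Fin d) (Fin d) ℂ)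
  set D : Matrix (Fin d) (Fin d) ℂ := Matrix.diagonal (RCLike.ofReal ∘ f ∘ hA.eigenvalues) with hD
  set E : Matrix (Fin d) (Fin d) ℂ := Matrix.diagonal (RCLike.ofReal ∘ g ∘ hB.eigenvalues) with hE
  have key : (U * D * star U * (V * E * star V)).trace
      = (D * (star U * V) * (E * star (star U * V))).trace := by
    rw [star_mul, star_star, mul_assoc U D, mul_assoc U, Matrix.trace_mul_comm]
    simp only [mul_assoc]
  rw [key, Matrix.trace, Complex.re_sum]
  refine Finset.sum_congr rfl fun i _ => ?_
  rw [Matrix.diag_apply, Matrix.mul_apply, Complex.re_sum]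
  refine Finset.sum_congr rfl fun j _ => ?_
  rw [hD, hE, Matrix.diagonal_mul, Matrix.diagonal_mul, Matrix.star_apply]
  set z := (star U * V) i j
  simp [Complex.normSq_apply]
  ring

lemma reTr_mpow_mul_mpow (hA : A.PosDef) (hB : B.PosDef) (s : ℝ) :
    reTr (mpow A (1 - s) * mpow B s) = ∑ i, ∑ j,
      hA.1.eigenvalues i * spectralOverlap hA.1 hB.1 i j *
        Real.exp (s * (Real.log (hB.1.eigenvalues j) - Real.log (hA.1.eigenvalues i))) := by
  rw [mpow, mpow, reTr_matFun_mul_matFun hA.1 hB.1]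
  refine Finset.sum_congr rfl fun i _ => Finset.sum_congr rfl fun j _ => ?_
  have hi := hA.eigenvalues_pos i
  have hj := hB.eigenvalues_pos j
  rw [if_neg hi.ne', if_neg hj.ne', Real.rpow_sub hi, Real.rpow_one,
    Real.rpow_def_of_pos hi, Real.rpow_def_of_pos hj, mul_sub, Real.exp_sub,
    mul_comm s, mul_comm s]
  field_simp

lemma qD_eq_sum_spectralOverlap (hA : A.IsHermitian) (hB : B.IsHermitian) :
    qD A B = ∑ i, ∑ j, hA.eigenvalues i * spectralOverlap hA hB i j *
      (Real.log (hA.eigenvalues i) - Real.log (hB.eigenvalues j)) := by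
  have h1 : A * mlog A = matFun (fun t => t * Real.log t) A * matFun (fun _ => 1) B := by
    rw [matFun_one hB, mul_one, ← matFun_mul_matFun hA (fun t => t), matFun_id hA, mlog]
  have h2 : A * mlog B = matFun (fun t => t) A * matFun Real.log B := by
    rw [matFun_id hA, mlog]
  have h3 : qD A B = reTr (A * mlog A) - reTr (A * mlog B) := by
    simp [qD, reTr, mul_sub, Matrix.trace_sub]
  rw [h3, h1, h2, reTr_matFun_mul_matFun hA hB, reTr_matFun_mul_matFun hA hB,
    ← Finset.sum_sub_distrib]
  refine Finset.sum_congr rfl fun i _ => ?_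
  rw [← Finset.sum_sub_distrib]
  exact Finset.sum_congr rfl fun j _ => by ring

lemma sum_eigenvalues_mul_spectralOverlap (hA : A.IsHermitian) (hB : B.IsHermitian) :
    ∑ i, ∑ j, hA.eigenvalues i * spectralOverlap hA hB i j = reTr A := by
  have h := reTr_matFun_mul_matFun hA hB (fun t => t) (fun _ => 1)
  rw [matFun_id hA, matFun_one hB, mul_one] at h
  simpa using h.symm

end SpectralOverlap

section ExpSum

variable {K : Type*} [Fintype K] {p : K → ℝ} (a : K → ℝ)

lemma hasDerivAt_sum_mul_exp (p : K → ℝ) (s : ℝ) :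
    HasDerivAt (fun t => ∑ k, p k * Real.exp (t * a k))
      (∑ k, p k * (a k * Real.exp (s * a k))) s := by
  refine HasDerivAt.fun_sum fun k _ => ?_
  have h := (((hasDerivAt_id s).mul_const (a k)).exp).const_mul (p k)
  simpa [mul_comm] using h

lemma sum_mul_exp_pos (hp : ∀ k, 0 ≤ p k) (h1 : ∑ k, p k = 1) (s : ℝ) :
    0 < ∑ k, p k * Real.exp (s * a k) := by
  obtain ⟨k, -, hk⟩ : ∃ k ∈ Finset.univ, p k ≠ 0 :=
    Finset.exists_ne_zero_of_sum_ne_zero (by rw [h1]; exact one_ne_zero)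
  exact Finset.sum_pos' (fun k _ => mul_nonneg (hp k) (Real.exp_pos _).le)
    ⟨k, Finset.mem_univ k, mul_pos ((hp k).lt_of_ne' hk) (Real.exp_pos _)⟩

/-- Chebyshev's association inequality for `a` and `exp (s * a)` under the weights `p`. -/
lemma sum_mul_sum_mul_exp_le (hp : ∀ k, 0 ≤ p k) (h1 : ∑ k, p k = 1) {s : ℝ} (hs : 0 ≤ s) :
    (∑ k, p k * a k) * ∑ k, p k * Real.exp (s * a k) ≤
      ∑ k, p k * (a k * Real.exp (s * a k)) := by
  have hnn : 0 ≤ ∑ k, ∑ l, p k * p l * ((a k - a l) *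
      (Real.exp (s * a k) - Real.exp (s * a l))) := by
    refine Finset.sum_nonneg fun k _ => Finset.sum_nonneg fun l _ =>
      mul_nonneg (mul_nonneg (hp k) (hp l)) ?_
    rcases le_total (a k) (a l) with h | h
    · exact mul_nonneg_of_nonpos_of_nonpos (sub_nonpos.2 h)
        (sub_nonpos.2 (Real.exp_le_exp.2 (mul_le_mul_of_nonneg_left h hs)))
    · exact mul_nonneg (sub_nonneg.2 h)
        (sub_nonneg.2 (Real.exp_le_exp.2 (mul_le_mul_of_nonneg_left h hs)))
  have hexpand : ∑ k, ∑ l, p k * p l * ((a k - a l) *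
      (Real.exp (s * a k) - Real.exp (s * a l))) =
      (∑ k, p k * (a k * Real.exp (s * a k))) * (∑ l, p l)
        + (∑ k, p k) * (∑ l, p l * (a l * Real.exp (s * a l)))
        - (∑ k, p k * a k) * (∑ l, p l * Real.exp (s * a l))
        - (∑ k, p k * Real.exp (s * a k)) * (∑ l, p l * a l) := by
    simp only [Finset.sum_mul_sum, ← Finset.sum_add_distrib, ← Finset.sum_sub_distrib]
    exact Finset.sum_congr rfl fun k _ => Finset.sum_congr rfl fun l _ => by ring
  rw [hexpand, h1] at hnn
  linarith

lemma hasDerivAt_neg_log_sum_mul_exp (hp : ∀ k, 0 ≤ p k) (h1 : ∑ k, p k = 1) (s : ℝ) :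
    HasDerivAt (fun t => -Real.log (∑ k, p k * Real.exp (t * a k)))
      (-((∑ k, p k * (a k * Real.exp (s * a k))) / ∑ k, p k * Real.exp (s * a k))) s :=
  ((hasDerivAt_sum_mul_exp a p s).log (sum_mul_exp_pos a hp h1 s).ne').neg

end ExpSum

/-- **Derivative bound for the modified auxiliary function `Ẽ₀`.** -/
theorem E0Tilde_deriv_le
    {X : Type} [Fintype X] {d : ℕ}
    (W : X → Matrix (Fin d) (Fin d) ℂ) (hW : ∀ x, (W x).PosDef ∧ (W x).trace = 1)
    (σ : Matrix (Fin d) (Fin d) ℂ) (hσ : σ.PosDef ∧ σ.trace = 1)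
    (P : X → ℝ) (hP : IsProbDist P) :
    ∀ s : ℝ, 0 ≤ s →
      DifferentiableAt ℝ (fun t => E0Tilde W t P σ) s ∧
      deriv (fun t => E0Tilde W t P σ) s ≤ ∑ x, P x * qD (W x) σ := by
  intro s hs
  let p : X × Fin d × Fin d → ℝ := fun k => P k.1 *
    ((hW k.1).1.1.eigenvalues k.2.1 * spectralOverlap (hW k.1).1.1 hσ.1.1 k.2.1 k.2.2)
  let a : X × Fin d × Fin d → ℝ := fun k =>
    Real.log (hσ.1.1.eigenvalues k.2.2) - Real.log ((hW k.1).1.1.eigenvalues k.2.1)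
  have hp : ∀ k, 0 ≤ p k := fun k => mul_nonneg (hP.1 k.1)
    (mul_nonneg ((hW k.1).1.eigenvalues_pos k.2.1).le (Complex.normSq_nonneg _))
  have h1 : ∑ k, p k = 1 := by
    simp only [p, Fintype.sum_prod_type, ← Finset.mul_sum]
    simp only [sum_eigenvalues_mul_spectralOverlap (hW _).1.1 hσ.1.1, reTr, (hW _).2,
      Complex.one_re, mul_one, hP.2]
  have hfun : (fun t => E0Tilde W t P σ) =
      fun t => -Real.log (∑ k, p k * Real.exp (t * a k)) := by
    funext t
    simp only [E0Tilde, p, a, Fintype.sum_prod_type, mul_assoc (P _), ← Finset.mul_sum]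
    simp only [reTr_mpow_mul_mpow (hW _).1 hσ.1]
  have hD : ∑ x, P x * qD (W x) σ = -∑ k, p k * a k := by
    simp only [p, a, Fintype.sum_prod_type, mul_assoc (P _), ← Finset.mul_sum]
    simp only [qD_eq_sum_spectralOverlap (hW _).1.1 hσ.1.1, ← Finset.sum_neg_distrib,
      ← mul_neg, neg_sub]
  have hder := hasDerivAt_neg_log_sum_mul_exp a hp h1 s
  rw [hfun, hD]
  refine ⟨hder.differentiableAt, ?_⟩
  rw [hder.deriv, neg_le_neg_iff, le_div_iff₀ (sum_mul_exp_pos a hp h1 s)]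
  exact sum_mul_sum_mul_exp_le a hp h1 hs

end MDQ
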